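/- arXiv:1705.07603 — 4 statements merged into one kernel-verified Lean document; each statement's English description precedes it below -/
import Mathlib

section
/- For every finitely supported U : H → ℝ^m with Ω(U) ≤ τ, there exists a finitely supported U' : H → ℝ^m with at most nm + 1 nonzero rows such that Ω(U') ≤ τ and o(x_i; U') = o(x_i; U) for all i ∈ [n]. Consequently, if the problem min_{Ω(U) ≤ τ} Σ_{i=1}^n ℓ(y_i, o(x_i; U)) admits a minimizer, then it admits a minimizer whose row support has size at most nm + 1. -/
/-- Squared-sum (Euclidean / l2) norm of a vector in `ℝ^d`. -/
noncomputable def l2n {d : ℕ} (v : Fin d → ℝ) : ℝ := Real.sqrt (∑ i, (v i) ^ 2)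

/-- Output of the model `U` (a finitely supported map from basis vectors to rows in `ℝ^m`)
on input `x`: `o(x; U) = ∑_{h} σ(hᵀx) u_h`. -/
noncomputable def outp {d m : ℕ} (σ : ℝ → ℝ) (U : (Fin d → ℝ) →₀ (Fin m → ℝ))
    (x : Fin d → ℝ) : Fin m → ℝ :=
  U.sum fun h u => σ (∑ j, h j * x j) • u

/-- Penalty `Ω(U) = ∑_h ω(u_h)`. -/
noncomputable def pen {d m : ℕ} (ω : (Fin m → ℝ) → ℝ)
    (U : (Fin d → ℝ) →₀ (Fin m → ℝ)) : ℝ :=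
  U.sum fun _ u => ω u

/-- All basis vectors in the (row) support of `U` lie in the l2 unit ball `H`. -/
def inBall {d m : ℕ} (U : (Fin d → ℝ) →₀ (Fin m → ℝ)) : Prop :=
  ∀ h ∈ U.support, l2n h ≤ 1

/-- A nontrivial relation among the images of the nonzero rows allows one row to be removed without
increasing the penalty. -/
lemma exists_support_ssubset_of_finrank_lt {ι E V : Type*} [AddCommGroup E] [Module ℝ E]
    [AddCommGroup V] [Module ℝ V] [FiniteDimensional ℝ V] (F : ι → E →ₗ[ℝ] V) (ω : E → ℝ)
    (hsmul : ∀ (c : ℝ) v, 0 ≤ c → ω (c • v) = c * ω v) (hpos : ∀ v, v ≠ 0 → 0 < ω v)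
    (U : ι →₀ E) (hU : Module.finrank ℝ V < U.support.card) :
    ∃ U' : ι →₀ E, U'.support ⊂ U.support ∧
      (U'.sum fun _ u => ω u) ≤ (U.sum fun _ u => ω u) ∧
      (U'.sum fun h u => F h u) = U.sum fun h u => F h u := by
  have hω0 : ω 0 = 0 := by simpa using hsmul 0 0 le_rfl
  obtain ⟨a, ha, hane, hasum⟩ : ∃ a : ι → ℝ, ∑ h ∈ U.support, a h • F h (U h) = 0 ∧
      (∃ h ∈ U.support, a h ≠ 0) ∧ 0 ≤ ∑ h ∈ U.support, a h * ω (U h) := by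
    have hdep : ¬ LinearIndepOn ℝ (fun h => F h (U h)) (U.support : Set ι) := by
      intro hli
      have hcard := LinearIndependent.fintype_card_le_finrank hli
      simp only [Finset.coe_sort_coe, Fintype.card_coe] at hcard
      omega
    rw [linearIndepOn_finset_iff] at hdep
    push Not at hdep
    obtain ⟨a, ha, h, hh, hah⟩ := hdep
    rcases le_total 0 (∑ h ∈ U.support, a h * ω (U h)) with hs | hs
    · exact ⟨a, ha, ⟨h, hh, hah⟩, hs⟩
    · exact ⟨-a, by simp [ha], ⟨h, hh, by simpa using hah⟩, by simpa using hs⟩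
  obtain ⟨h₀, hh₀, hah₀⟩ : ∃ h ∈ U.support, 0 < a h := by
    by_contra! hneg
    obtain ⟨h, hh, hah⟩ := hane
    have hlt : ∑ h ∈ U.support, a h * ω (U h) < ∑ h ∈ U.support, 0 :=
      Finset.sum_lt_sum
        (fun k hk => mul_nonpos_of_nonpos_of_nonneg (hneg k hk)
          (hpos _ (Finsupp.mem_support_iff.mp hk)).le)
        ⟨h, hh, mul_neg_of_neg_of_pos ((hneg h hh).lt_of_ne hah)
          (hpos _ (Finsupp.mem_support_iff.mp hh))⟩
    simp only [Finset.sum_const_zero] at hlt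
    linarith
  obtain ⟨k, hk, hmax⟩ := U.support.exists_max_image a ⟨h₀, hh₀⟩
  have hak : 0 < a k := hah₀.trans_le (hmax h₀ hh₀)
  have hc : ∀ h ∈ U.support, 0 ≤ 1 - (a k)⁻¹ * a h := fun h hh => by
    rw [sub_nonneg, inv_mul_le_one₀ hak]
    exact hmax h hh
  let U' : ι →₀ E := Finsupp.onFinset U.support (fun h => (1 - (a k)⁻¹ * a h) • U h) (by
    intro h hne
    rw [Finsupp.mem_support_iff]
    rintro h0
    simp [h0] at hne)
  have hsub : U'.support ⊆ U.support := Finsupp.support_onFinset_subset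
  refine ⟨U', (Finset.ssubset_iff_of_subset hsub).mpr ⟨k, hk, ?_⟩, ?_, ?_⟩
  · simp [U', hak.ne']
  · rw [Finsupp.sum_of_support_subset _ hsub _ (fun _ _ => hω0), Finsupp.sum]
    have heq : ∑ h ∈ U.support, ω (U' h) =
        ∑ h ∈ U.support, ω (U h) - (a k)⁻¹ * ∑ h ∈ U.support, a h * ω (U h) := by
      rw [Finset.mul_sum, ← Finset.sum_sub_distrib]
      refine Finset.sum_congr rfl fun h hh => ?_
      simp only [U', Finsupp.onFinset_apply]
      rw [hsmul _ _ (hc h hh)]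
      ring
    rw [heq]
    have := mul_nonneg (inv_nonneg.mpr hak.le) hasum
    linarith
  · rw [Finsupp.sum_of_support_subset _ hsub _ (fun _ _ => map_zero _), Finsupp.sum]
    have heq : ∑ h ∈ U.support, F h (U' h) =
        ∑ h ∈ U.support, F h (U h) - (a k)⁻¹ • ∑ h ∈ U.support, a h • F h (U h) := by
      rw [Finset.smul_sum, ← Finset.sum_sub_distrib]
      refine Finset.sum_congr rfl fun h _ => ?_
      simp [U', sub_smul, mul_smul]
    rw [heq, ha, smul_zero, sub_zero]

/-- Conic Carathéodory reduction for finitely supported families of rows. -/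
lemma exists_support_card_le_finrank {ι E V : Type*} [AddCommGroup E] [Module ℝ E]
    [AddCommGroup V] [Module ℝ V] [FiniteDimensional ℝ V] (F : ι → E →ₗ[ℝ] V) (ω : E → ℝ)
    (hsmul : ∀ (c : ℝ) v, 0 ≤ c → ω (c • v) = c * ω v) (hpos : ∀ v, v ≠ 0 → 0 < ω v)
    (U : ι →₀ E) :
    ∃ U' : ι →₀ E, U'.support ⊆ U.support ∧ U'.support.card ≤ Module.finrank ℝ V ∧
      (U'.sum fun _ u => ω u) ≤ (U.sum fun _ u => ω u) ∧
      (U'.sum fun h u => F h u) = U.sum fun h u => F h u := by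
  induction hN : U.support.card using Nat.strong_induction_on generalizing U with
  | _ N ih =>
    by_cases hU : U.support.card ≤ Module.finrank ℝ V
    · exact ⟨U, subset_rfl, hU, le_rfl, rfl⟩
    · obtain ⟨W, hWs, hWω, hWF⟩ :=
        exists_support_ssubset_of_finrank_lt F ω hsmul hpos U (not_le.mp hU)
      obtain ⟨U', hs, hcard, hω, hF⟩ := ih _ (hN ▸ Finset.card_lt_card hWs) W rfl
      exact ⟨U', hs.trans hWs.subset, hcard, hω.trans hWω, hF.trans hWF⟩

lemma l2n_eq_norm {m : ℕ} (v : Fin m → ℝ) : l2n v = ‖WithLp.toLp 2 v‖ := by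
  simp [l2n, EuclideanSpace.norm_eq]

theorem stmt0 (n d m : ℕ) (x : Fin n → Fin d → ℝ) (y : Fin n → Fin m)
    (σ : ℝ → ℝ) (ℓ : Fin m → (Fin m → ℝ) → ℝ) (τ : ℝ) (hτ : 0 < τ)
    (ω : (Fin m → ℝ) → ℝ)
    (hω : ω = (fun v => ∑ c, |v c|) ∨ ω = (fun v => l2n v) ∨ ω = (fun v => ‖v‖)) :
    -- part 1: any feasible U can be replaced by one with at most nm+1 nonzero rows,
    -- with the same outputs on the training points
    (∀ U : (Fin d → ℝ) →₀ (Fin m → ℝ), inBall U → pen ω U ≤ τ →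
      ∃ U' : (Fin d → ℝ) →₀ (Fin m → ℝ), inBall U' ∧ U'.support.card ≤ n * m + 1 ∧
        pen ω U' ≤ τ ∧ ∀ i : Fin n, outp σ U' (x i) = outp σ U (x i)) ∧
    -- part 2: if the problem admits a minimizer, it admits one with ≤ nm+1 nonzero rows
    ((∃ U : (Fin d → ℝ) →₀ (Fin m → ℝ), (inBall U ∧ pen ω U ≤ τ) ∧
        ∀ V : (Fin d → ℝ) →₀ (Fin m → ℝ), inBall V → pen ω V ≤ τ →
          (∑ i, ℓ (y i) (outp σ U (x i))) ≤ ∑ i, ℓ (y i) (outp σ V (x i))) →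
      ∃ U' : (Fin d → ℝ) →₀ (Fin m → ℝ), (inBall U' ∧ pen ω U' ≤ τ) ∧
        U'.support.card ≤ n * m + 1 ∧
        ∀ V : (Fin d → ℝ) →₀ (Fin m → ℝ), inBall V → pen ω V ≤ τ →
          (∑ i, ℓ (y i) (outp σ U' (x i))) ≤ ∑ i, ℓ (y i) (outp σ V (x i))) := by
  have hsmul : ∀ (c : ℝ) v, 0 ≤ c → ω (c • v) = c * ω v := by
    intro c v hc
    rcases hω with rfl | rfl | rfl
    · simp [abs_mul, abs_of_nonneg hc, Finset.mul_sum]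
    · simp [l2n_eq_norm, norm_smul, abs_of_nonneg hc]
    · simp [norm_smul, abs_of_nonneg hc]
  have hpos : ∀ v, v ≠ 0 → 0 < ω v := by
    intro v hv
    rcases hω with rfl | rfl | rfl
    · obtain ⟨c, hc⟩ := Function.ne_iff.mp hv
      exact Finset.sum_pos' (fun _ _ => abs_nonneg _) ⟨c, Finset.mem_univ c, abs_pos.mpr hc⟩
    · simpa [l2n_eq_norm] using hv
    · simpa using hv
  have reduce : ∀ U : (Fin d → ℝ) →₀ (Fin m → ℝ), inBall U → pen ω U ≤ τ →
      ∃ U' : (Fin d → ℝ) →₀ (Fin m → ℝ), inBall U' ∧ U'.support.card ≤ n * m + 1 ∧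
        pen ω U' ≤ τ ∧ ∀ i : Fin n, outp σ U' (x i) = outp σ U (x i) := by
    intro U hball hpen
    let F : (Fin d → ℝ) → (Fin m → ℝ) →ₗ[ℝ] (Fin n → Fin m → ℝ) := fun h =>
      LinearMap.pi fun i => σ (∑ j, h j * x i j) • LinearMap.id
    obtain ⟨U', hs, hcard, hω', hF⟩ := exists_support_card_le_finrank F ω hsmul hpos U
    refine ⟨U', fun h hh => hball h (hs hh), ?_, hω'.trans hpen, fun i => ?_⟩
    · rw [Module.finrank_pi_fintype] at hcard
      simp at hcard
      omega
    · simpa [F, outp, Finsupp.sum, Finset.sum_apply] using congrFun hF i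
  refine ⟨reduce, ?_⟩
  rintro ⟨U, ⟨hball, hpen⟩, hmin⟩
  obtain ⟨U', hball', hcard, hpen', hout⟩ := reduce U hball hpen
  exact ⟨U', ⟨hball', hpen'⟩, hcard, fun V hV hVp => by simpa only [hout] using hmin V hV hVp⟩
end

section
/- For every symmetric M ∈ ℝ^{d×d}, ‖M‖_* equals the minimum, over all λ ∈ ℝ^d and P ∈ ℝ^{d×d} with columns p_1,…,p_d satisfying M = Σ_{j=1}^d λ_j p_j p_jᵀ, of Σ_{j=1}^d |λ_j| ‖p_j‖₂²; the minimum is attained by an orthonormal eigendecomposition M = Σ_{j=1}^d λ_j p_j p_jᵀ (λ the eigenvalues of M, p_j orthonormal eigenvectors), for which the objective value equals ‖λ‖₁. -/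
open Matrix in
theorem Matrix.sum_smul_vecMulVec_col {m n R : Type*} [Fintype n] [DecidableEq n] [CommSemiring R]
    (a : n → R) (P : Matrix m n R) :
    ∑ j, a j • vecMulVec (fun i => P i j) (fun i => P i j) = P * diagonal a * Pᵀ := by
  ext i k
  rw [mul_apply]
  simp only [sum_apply, smul_apply, vecMulVec_apply, smul_eq_mul, mul_diagonal, transpose_apply]
  exact Finset.sum_congr rfl fun j _ => by ring

open Matrix in
theorem Matrix.transpose_mul_self_apply_self {m n R : Type*} [Fintype m] [CommSemiring R]
    (P : Matrix m n R) (j : n) : (Pᵀ * P) j j = ∑ i, P i j ^ 2 := by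
  simp only [mul_apply, transpose_apply, sq]

open Matrix in
theorem Matrix.IsHermitian.exists_orthogonal_diagonalization {n : Type*} [Fintype n]
    [DecidableEq n] {M : Matrix n n ℝ} (hM : M.IsHermitian) :
    ∃ U : Matrix n n ℝ, Uᵀ * U = 1 ∧ U * Uᵀ = 1 ∧ M = U * diagonal hM.eigenvalues * Uᵀ := by
  refine ⟨hM.eigenvectorUnitary, ?_, ?_, ?_⟩
  · simpa [star_eq_conjTranspose] using Unitary.coe_star_mul_self hM.eigenvectorUnitary
  · simpa [star_eq_conjTranspose] using Unitary.coe_mul_star_self hM.eigenvectorUnitary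
  · simpa [star_eq_conjTranspose, Unitary.conjStarAlgAut_apply, Function.comp_def]
      using hM.spectral_theorem

open Matrix in
/-- If `D = Q diag(a) Qᵀ` is diagonal, the absolute values of its entries sum to at most
`∑ j, |a j| * ‖q j‖ ^ 2`, where `q j` are the columns of `Q`. -/
theorem Matrix.sum_abs_le_of_diagonal_eq {m n : Type*} [Fintype m] [Fintype n] [DecidableEq m]
    [DecidableEq n] {b : m → ℝ} {a : n → ℝ} {Q : Matrix m n ℝ}
    (h : diagonal b = Q * diagonal a * Qᵀ) :
    ∑ k, |b k| ≤ ∑ j, |a j| * ∑ k, Q k j ^ 2 := by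
  have hb (k : m) : b k = ∑ j, a j * Q k j ^ 2 := by
    have hk := congrFun (congrFun h k) k
    rw [diagonal_apply_eq, mul_apply] at hk
    rw [hk]
    refine Finset.sum_congr rfl fun j _ => ?_
    rw [mul_diagonal, transpose_apply]
    ring
  calc ∑ k, |b k| ≤ ∑ k, ∑ j, |a j| * Q k j ^ 2 := by
        refine Finset.sum_le_sum fun k _ => ?_
        rw [hb k]
        refine (Finset.abs_sum_le_sum_abs _ _).trans_eq ?_
        simp only [abs_mul, abs_pow, sq_abs]
    _ = ∑ j, |a j| * ∑ k, Q k j ^ 2 := by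
        rw [Finset.sum_comm]
        simp only [Finset.mul_sum]

/-- Variational characterization of the nuclear norm of a real symmetric matrix:
for symmetric `M`, the nuclear norm (= sum of absolute values of its eigenvalues)
is the least value of `∑_j |λ_j| ‖p_j‖₂²` over all decompositions
`M = ∑_j λ_j p_j p_jᵀ`; the minimum is attained by an orthonormal
eigendecomposition, for which the objective value equals `‖λ‖₁`. -/
theorem stmt2 (d : ℕ) (M : Matrix (Fin d) (Fin d) ℝ) (hM : M.IsHermitian) :
    IsLeast
      {v : ℝ | ∃ (lam : Fin d → ℝ) (P : Matrix (Fin d) (Fin d) ℝ),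
        M = ∑ j, lam j • Matrix.vecMulVec (fun i => P i j) (fun i => P i j) ∧
        v = ∑ j, |lam j| * (∑ i, (P i j) ^ 2)}
      (∑ j, |hM.eigenvalues j|) ∧
    ∃ P : Matrix (Fin d) (Fin d) ℝ,
      (∀ j j' : Fin d, (∑ i, P i j * P i j') = if j = j' then 1 else 0) ∧
      M = ∑ j, hM.eigenvalues j • Matrix.vecMulVec (fun i => P i j) (fun i => P i j) ∧
      (∑ j, |hM.eigenvalues j| * (∑ i, (P i j) ^ 2)) = ∑ j, |hM.eigenvalues j| := by
  obtain ⟨U, hUU, hUU', hU⟩ := hM.exists_orthogonal_diagonalization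
  have hdecomp := hU.trans (Matrix.sum_smul_vecMulVec_col hM.eigenvalues U).symm
  have hval : ∑ j, |hM.eigenvalues j| * ∑ i, U i j ^ 2 = ∑ j, |hM.eigenvalues j| := by
    simp only [← Matrix.transpose_mul_self_apply_self, hUU, Matrix.one_apply_eq, mul_one]
  refine ⟨⟨⟨hM.eigenvalues, U, hdecomp, hval.symm⟩, ?_⟩, U, fun j k => ?_, hdecomp, hval⟩
  · rintro v ⟨a, P, hP, rfl⟩
    rw [Matrix.sum_smul_vecMulVec_col] at hP
    have hdiag : Matrix.diagonal hM.eigenvalues =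
        (U.transpose * P) * Matrix.diagonal a * (U.transpose * P).transpose := by
      calc Matrix.diagonal hM.eigenvalues
          = (U.transpose * U) * Matrix.diagonal hM.eigenvalues * (U.transpose * U) := by
            rw [hUU, one_mul, mul_one]
        _ = U.transpose * (U * Matrix.diagonal hM.eigenvalues * U.transpose) * U := by
            simp only [Matrix.mul_assoc]
        _ = U.transpose * (P * Matrix.diagonal a * P.transpose) * U := by rw [← hU, ← hP]
        _ = _ := by
            simp only [Matrix.transpose_mul, Matrix.transpose_transpose, Matrix.mul_assoc]
    have hgram : (U.transpose * P).transpose * (U.transpose * P) = P.transpose * P := by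
      rw [Matrix.transpose_mul, Matrix.transpose_transpose, Matrix.mul_assoc,
        ← Matrix.mul_assoc U, hUU', one_mul]
    refine (Matrix.sum_abs_le_of_diagonal_eq hdiag).trans_eq ?_
    simp only [← Matrix.transpose_mul_self_apply_self, hgram]
  · simpa only [Matrix.mul_apply, Matrix.transpose_apply, Matrix.one_apply]
      using congrFun (congrFun hUU j) k
end

section
/- Fix ν ∈ (0,1]. Let x^0 ∈ D and for t ≥ 0 define x^{t+1} := (1 − γ_t) x^t + γ_t s_t with step size γ_t = 2/(t+2), where s_t ∈ D satisfies ⟨−s_t, ∇f(x^t)⟩ ≥ ν · max_{s∈D} ⟨−s, ∇f(x^t)⟩. Then every iterate satisfies x^t ∈ D, and for every t ≥ 1, f(x^t) ≤ min_{Ω(x) ≤ ντ} f(x) + 8τ²β/(t + 2). -/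
/-- First-order lower bound for a convex differentiable function. -/
theorem ConvexOn.add_fderiv_sub_le {E : Type*} [NormedAddCommGroup E] [NormedSpace ℝ E]
    {f : E → ℝ} (hconv : ConvexOn ℝ Set.univ f) {a : E} (hdiff : DifferentiableAt ℝ f a) (b : E) :
    f a + fderiv ℝ f a (b - a) ≤ f b := by
  have hline : ConvexOn ℝ Set.univ (f ∘ AffineMap.lineMap (k := ℝ) a b) := by
    simpa using hconv.comp_affineMap (AffineMap.lineMap (k := ℝ) a b)
  have hder : HasDerivAt (f ∘ AffineMap.lineMap (k := ℝ) a b) (fderiv ℝ f a (b - a)) 0 := by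
    refine HasFDerivAt.comp_hasDerivAt (0 : ℝ) ?_ AffineMap.hasDerivAt_lineMap
    simpa using hdiff.hasFDerivAt
  have h := hline.le_slope_of_hasDerivAt (Set.mem_univ 0) (Set.mem_univ 1) one_pos hder
  simp only [slope_def_field, Function.comp_apply, AffineMap.lineMap_apply_one,
    AffineMap.lineMap_apply_zero, sub_zero, div_one] at h
  linarith

/-- The descent lemma: quadratic upper bound for a function whose derivative is Lipschitz with
respect to an absolutely homogeneous gauge. -/
theorem le_add_fderiv_add_of_smooth {E : Type*} [NormedAddCommGroup E] [NormedSpace ℝ E]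
    {Ω f : E → ℝ} {β : ℝ} (hΩsmul : ∀ (c : ℝ) (a), Ω (c • a) = |c| * Ω a)
    (hdiff : Differentiable ℝ f)
    (hsmooth : ∀ a b z, fderiv ℝ f a z - fderiv ℝ f b z ≤ β * Ω (a - b) * Ω z) (a d : E) :
    f (a + d) ≤ f a + fderiv ℝ f a d + β / 2 * Ω d ^ 2 := by
  have hder (u : ℝ) :
      HasDerivAt (fun u : ℝ => f (a + u • d) - u * fderiv ℝ f a d - β / 2 * Ω d ^ 2 * u ^ 2)
        (fderiv ℝ f (a + u • d) d - fderiv ℝ f a d - β * Ω d ^ 2 * u) u := by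
    have hline : HasDerivAt (fun u : ℝ => a + u • d) d u := by
      simpa using ((hasDerivAt_id u).smul_const d).const_add a
    have hf := (hdiff (a + u • d)).hasFDerivAt.comp_hasDerivAt u hline
    refine ((hf.sub ((hasDerivAt_id u).mul_const (fderiv ℝ f a d))).sub
      ((hasDerivAt_pow 2 u).const_mul (β / 2 * Ω d ^ 2))).congr_deriv ?_
    push_cast
    ring
  have hanti : AntitoneOn
      (fun u : ℝ => f (a + u • d) - u * fderiv ℝ f a d - β / 2 * Ω d ^ 2 * u ^ 2)
      (Set.Icc 0 1) := by
    refine antitoneOn_of_deriv_nonpos (convex_Icc 0 1)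
      (fun u _ => (hder u).continuousAt.continuousWithinAt)
      (fun u _ => (hder u).differentiableAt.differentiableWithinAt) fun u hu => ?_
    rw [interior_Icc] at hu
    rw [(hder u).deriv]
    have h := hsmooth (a + u • d) a d
    rw [add_sub_cancel_left, hΩsmul, abs_of_pos hu.1] at h
    linarith
  have h := hanti (Set.left_mem_Icc.2 zero_le_one) (Set.right_mem_Icc.2 zero_le_one) zero_le_one
  norm_num at h
  linarith

/-- Frank–Wolfe with a ν-multiplicatively approximate linear minimization oracle over
`D = {x : Ω x ≤ τ}`: all iterates stay in `D`, and for every `t ≥ 1`,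
`f(x^t) ≤ min_{Ω(x) ≤ ντ} f(x) + 8τ²β/(t+2)`. -/
theorem stmt5 (N : ℕ) (Ω : (Fin N → ℝ) → ℝ)
    (hΩadd : ∀ a b, Ω (a + b) ≤ Ω a + Ω b)
    (hΩsmul : ∀ (c : ℝ) (a), Ω (c • a) = |c| * Ω a)
    (hΩdef : ∀ a, Ω a = 0 ↔ a = 0)
    (f : (Fin N → ℝ) → ℝ) (hconv : ConvexOn ℝ Set.univ f) (hdiff : Differentiable ℝ f)
    (β τ : ℝ) (hβ : 0 ≤ β) (hτ : 0 < τ)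
    -- β-smoothness w.r.t. Ω: Ω*(∇f(a) − ∇f(b)) ≤ β Ω(a − b), stated pointwise
    (hsmooth : ∀ a b z, fderiv ℝ f a z - fderiv ℝ f b z ≤ β * Ω (a - b) * Ω z)
    (ν : ℝ) (hν0 : 0 < ν) (hν1 : ν ≤ 1)
    (x s : ℕ → Fin N → ℝ)
    (hx0 : Ω (x 0) ≤ τ)
    (hs : ∀ t, Ω (s t) ≤ τ)
    -- ν-approximate LMO over D: ⟨−s_t, ∇f(x^t)⟩ ≥ ν · max_{s ∈ D} ⟨−s, ∇f(x^t)⟩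
    (happrox : ∀ t, ∀ s', Ω s' ≤ τ →
      ν * fderiv ℝ f (x t) (-s') ≤ fderiv ℝ f (x t) (-(s t)))
    (hrec : ∀ t : ℕ,
      x (t + 1) = (1 - 2 / ((t : ℝ) + 2)) • x t + (2 / ((t : ℝ) + 2)) • s t) :
    (∀ t : ℕ, Ω (x t) ≤ τ) ∧
    ∀ t : ℕ, 1 ≤ t → ∀ z, Ω z ≤ ν * τ →
      f (x t) ≤ f z + 8 * τ ^ 2 * β / ((t : ℝ) + 2) := by
  have hγ0 (t : ℕ) : 0 ≤ 2 / ((t : ℝ) + 2) := by positivity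
  have hγ1 (t : ℕ) : 0 ≤ 1 - 2 / ((t : ℝ) + 2) := by
    rw [sub_nonneg, div_le_one (by positivity)]
    linarith [t.cast_nonneg (α := ℝ)]
  have hmem (t : ℕ) : Ω (x t) ≤ τ := by
    induction t with
    | zero => exact hx0
    | succ t ih =>
      rw [hrec]
      refine (hΩadd _ _).trans ?_
      rw [hΩsmul, hΩsmul, abs_of_nonneg (hγ0 t), abs_of_nonneg (hγ1 t)]
      nlinarith [mul_le_mul_of_nonneg_left ih (hγ1 t), mul_le_mul_of_nonneg_left (hs t) (hγ0 t)]
  refine ⟨hmem, fun t ht z hz => ?_⟩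
  have hneg (a : Fin N → ℝ) : Ω (-a) = Ω a := by simpa using hΩsmul (-1) a
  have hnonneg (a : Fin N → ℝ) : 0 ≤ Ω a := by
    have h := hΩadd a (-a)
    rw [add_neg_cancel, hneg, (hΩdef 0).2 rfl] at h
    linarith
  have hdiam (t : ℕ) : Ω (s t - x t) ≤ 2 * τ := by
    have h := hΩadd (s t) (-x t)
    rw [hneg, ← sub_eq_add_neg] at h
    linarith [hs t, hmem t]
  have hgap (t : ℕ) : fderiv ℝ f (x t) (s t - x t) ≤ f z - f (x t) := by
    have hz' : Ω (ν⁻¹ • z) ≤ τ := by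
      rw [hΩsmul, abs_of_pos (inv_pos.2 hν0), inv_mul_le_iff₀ hν0]
      exact hz
    have h := happrox t _ hz'
    rw [map_neg, map_neg, map_smul, smul_eq_mul, mul_neg, mul_inv_cancel_left₀ hν0.ne'] at h
    have hc := hconv.add_fderiv_sub_le (hdiff (x t)) z
    rw [map_sub] at hc ⊢
    linarith
  have hstep (t : ℕ) : f (x (t + 1)) - f z ≤
      (1 - 2 / ((t : ℝ) + 2)) * (f (x t) - f z) + 2 * β * τ ^ 2 * (2 / ((t : ℝ) + 2)) ^ 2 := by
    have hx : x (t + 1) = x t + (2 / ((t : ℝ) + 2)) • (s t - x t) := by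
      rw [hrec]
      module
    have hd := le_add_fderiv_add_of_smooth hΩsmul hdiff hsmooth (x t)
      ((2 / ((t : ℝ) + 2)) • (s t - x t))
    rw [← hx, map_smul, smul_eq_mul, hΩsmul, abs_of_nonneg (hγ0 t), mul_pow] at hd
    have hsq : Ω (s t - x t) ^ 2 ≤ (2 * τ) ^ 2 := pow_le_pow_left₀ (hnonneg _) (hdiam t) 2
    have hquad := mul_le_mul_of_nonneg_left hsq
      (by positivity : 0 ≤ β / 2 * (2 / ((t : ℝ) + 2)) ^ 2)
    have hlin := mul_le_mul_of_nonneg_left (hgap t) (hγ0 t)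
    linarith
  have hrate (t : ℕ) : (1 - 2 / ((t : ℝ) + 2)) * (8 * τ ^ 2 * β / ((t : ℝ) + 2)) +
      2 * β * τ ^ 2 * (2 / ((t : ℝ) + 2)) ^ 2 ≤ 8 * τ ^ 2 * β / (((t + 1 : ℕ) : ℝ) + 2) := by
    have hC : 0 ≤ 8 * τ ^ 2 * β := by positivity
    have heq : (1 - 2 / ((t : ℝ) + 2)) * (8 * τ ^ 2 * β / ((t : ℝ) + 2)) +
        2 * β * τ ^ 2 * (2 / ((t : ℝ) + 2)) ^ 2 =
        8 * τ ^ 2 * β * ((t : ℝ) + 1) / ((t : ℝ) + 2) ^ 2 := by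
      field_simp
      ring
    rw [heq, div_le_div_iff₀ (by positivity) (by positivity), mul_assoc]
    refine mul_le_mul_of_nonneg_left ?_ hC
    push_cast
    nlinarith
  suffices h : f (x t) - f z ≤ 8 * τ ^ 2 * β / ((t : ℝ) + 2) by linarith
  induction t, ht using Nat.le_induction with
  | base =>
    have h0 := hstep 0
    have hr := hrate 0
    norm_num at h0 hr ⊢
    have hC : 0 ≤ β * τ ^ 2 := by positivity
    linarith
  | succ t _ ih =>
    exact (hstep t).trans ((add_le_add_left (mul_le_mul_of_nonneg_left ih (hγ1 t)) _).trans
      (hrate t))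
end

section
/- Fix ν ∈ (0,1] and x ∈ D. Suppose s ∈ D satisfies ⟨−s, ∇f(x)⟩ ≥ ν · max_{s'∈D} ⟨−s', ∇f(x)⟩. Then ⟨−s, ∇f(x)⟩ ≥ max_{Ω(s') ≤ ντ} ⟨−s', ∇f(x)⟩, and consequently ⟨s − x, ∇f(x)⟩ ≤ −g_{D'}(x), where D' := {x' ∈ ℝ^N : Ω(x') ≤ ντ} and g_{D'}(x) := max_{s'∈D'} ⟨x − s', ∇f(x)⟩. -/
/-- Absorbing the multiplicative factor in the constraint: if `x ∈ D = {x : Ω x ≤ τ}`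
and `s ∈ D` satisfies `⟨−s, ∇f(x)⟩ ≥ ν · max_{s' ∈ D} ⟨−s', ∇f(x)⟩`, then
`⟨−s, ∇f(x)⟩ ≥ max_{Ω(s') ≤ ντ} ⟨−s', ∇f(x)⟩`, and consequently
`⟨s − x, ∇f(x)⟩ ≤ −g_{D'}(x)` where `D' = {x' : Ω x' ≤ ντ}` and
`g_{D'}(x) = max_{s' ∈ D'} ⟨x − s', ∇f(x)⟩`. -/
theorem stmt9 (N : ℕ) (Ω : (Fin N → ℝ) → ℝ)
    (hΩadd : ∀ a b, Ω (a + b) ≤ Ω a + Ω b)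
    (hΩsmul : ∀ (c : ℝ) (a), Ω (c • a) = |c| * Ω a)
    (hΩdef : ∀ a, Ω a = 0 ↔ a = 0)
    (τ ν : ℝ) (hτ : 0 < τ) (hν0 : 0 < ν) (hν1 : ν ≤ 1)
    (f : (Fin N → ℝ) → ℝ) (hdiff : Differentiable ℝ f)
    (x s : Fin N → ℝ) (hx : Ω x ≤ τ) (hs : Ω s ≤ τ)
    -- ⟨−s, ∇f(x)⟩ ≥ ν · max_{s' ∈ D} ⟨−s', ∇f(x)⟩, stated pointwise
    (happrox : ∀ s', Ω s' ≤ τ → ν * fderiv ℝ f x (-s') ≤ fderiv ℝ f x (-s)) :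
    (∀ s', Ω s' ≤ ν * τ → fderiv ℝ f x (-s') ≤ fderiv ℝ f x (-s)) ∧
    fderiv ℝ f x (s - x)
      ≤ -sSup {v : ℝ | ∃ s', Ω s' ≤ ν * τ ∧ v = fderiv ℝ f x (x - s')} := by
  have hmax : ∀ s', Ω s' ≤ ν * τ → fderiv ℝ f x (-s') ≤ fderiv ℝ f x (-s) := by
    intro s' hs'
    have hscaled : Ω (ν⁻¹ • s') ≤ τ := by
      rw [hΩsmul, abs_of_pos (inv_pos.mpr hν0)]
      exact (inv_mul_le_iff₀ hν0).mpr hs'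
    have h := happrox _ hscaled
    rwa [← smul_neg, map_smul, smul_eq_mul, mul_inv_cancel_left₀ hν0.ne'] at h
  refine ⟨hmax, le_neg_of_le_neg (csSup_le ?_ ?_)⟩
  · exact ⟨_, 0, by rw [(hΩdef 0).mpr rfl]; positivity, rfl⟩
  · rintro v ⟨s', hs', rfl⟩
    have h := hmax s' hs'
    simp only [map_sub, map_neg] at h ⊢
    linarith
end
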